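/- There exists an 𝔽₄-rational point of the cubic surface S₁ lying on no line of the surface: there is a nonzero vector v ∈ 𝔽₄⁴ with f₁(v) = 0 such that, letting K be an algebraic closure of 𝔽₄ and viewing v in K⁴, no 2-dimensional K-linear subspace of K⁴ on which f₁ vanishes identically contains v. -/

import Mathlib

open MvPolynomial

/-- The cubic form `Y³ + Y²Z + Z³ + W(X² + Y² + YZ + Z²) + XW² + W³` with the variables
`X, Y, Z, W` indexed by `0, 1, 2, 3`, over any commutative ring (its coefficients lie in `𝔽₂`). -/
noncomputable def f₁ (K : Type*) [CommRing K] : MvPolynomial (Fin 4) K :=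
  X 1 ^ 3 + X 1 ^ 2 * X 2 + X 2 ^ 3
    + X 3 * (X 0 ^ 2 + X 1 ^ 2 + X 1 * X 2 + X 2 ^ 2) + X 0 * X 3 ^ 2 + X 3 ^ 3

lemma eval_f₁ {K : Type*} [CommRing K] (v : Fin 4 → K) :
    eval v (f₁ K) = v 1 ^ 3 + v 1 ^ 2 * v 2 + v 2 ^ 3
      + v 3 * (v 0 ^ 2 + v 1 ^ 2 + v 1 * v 2 + v 2 ^ 2) + v 0 * v 3 ^ 2 + v 3 ^ 3 := by
  simp [f₁]

lemma GaloisField.exists_sq_add_self_add_one_eq_zero :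
    ∃ ω : GaloisField 2 2, ω ^ 2 + ω + 1 = 0 := by
  classical
  have : Fintype (GaloisField 2 2) := Fintype.ofFinite _
  have hc : Fintype.card (GaloisField 2 2) = 4 := by
    rw [← Nat.card_eq_fintype_card, GaloisField.card 2 2 two_ne_zero]; norm_num
  obtain ⟨ω, hω⟩ := Finset.exists_mem_notMem_of_card_lt_card
    (s := ({0, 1} : Finset (GaloisField 2 2))) (t := Finset.univ)
    (by rw [Finset.card_univ, hc]; exact Finset.card_le_two.trans_lt (by norm_num))
  simp only [Finset.mem_insert, Finset.mem_singleton, not_or] at hω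
  have hp : ω ^ 4 = ω := by simpa [hc] using FiniteField.pow_card ω
  refine ⟨ω, mul_left_cancel₀ (mul_ne_zero hω.2.1 (sub_ne_zero.2 hω.2.2)) ?_⟩
  linear_combination hp

/-- In characteristic two, if `ω² + ω + 1 = 0`, then no line of the surface `f₁ = 0` joins the point
`(ω : 0 : 0 : 1)` to a point of the plane `W = 0`. -/
lemma eq_zero_of_eval_f₁_add_smul_eq_zero {K : Type*} [Field K] [CharP K 2] {ω : K}
    (hω : ω ^ 2 + ω + 1 = 0) {u : Fin 4 → K} (hu : u 3 = 0)
    (h : ∀ s : K, eval (u + s • ![ω, 0, 0, 1]) (f₁ K) = 0) : u = 0 := by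
  have h2 : (2 : K) = 0 := CharTwo.two_eq_zero
  have hexp (s : K) : u 1 ^ 3 + u 1 ^ 2 * u 2 + u 2 ^ 3
      + s * (u 0 ^ 2 + u 1 ^ 2 + u 1 * u 2 + u 2 ^ 2) + s ^ 2 * u 0 = 0 := by
    have := h s
    rw [eval_f₁] at this
    simp only [Pi.add_apply, Pi.smul_apply, smul_eq_mul, Matrix.cons_val, hu, mul_zero, add_zero,
      mul_one, zero_add] at this
    linear_combination this - s ^ 3 * hω - s ^ 2 * u 0 * ω * h2
  have hC : u 1 ^ 3 + u 1 ^ 2 * u 2 + u 2 ^ 3 = 0 := by simpa using hexp 0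
  have h1 := hexp 1
  have hx : u 0 = 0 := by
    linear_combination hexp ω - ω * h1 + (ω - 1) * hC - u 0 * hω + (1 + ω) * u 0 * h2
  have hQ : u 1 ^ 2 + u 1 * u 2 + u 2 ^ 2 = 0 := by
    rw [hx] at h1
    linear_combination h1 - hC
  have hab : u 1 ^ 2 * u 2 = 0 := by
    linear_combination hC - (u 1 - u 2) * hQ - u 2 ^ 3 * h2
  have hu12 : u 1 = 0 ∧ u 2 = 0 := by
    rcases mul_eq_zero.1 hab with ha | hb
    · have ha : u 1 = 0 := by simpa using ha
      simpa [ha] using hQ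
    · simpa [hb] using hQ
  funext i
  fin_cases i
  exacts [hx, hu12.1, hu12.2, hu]

/-- There exists an `𝔽₄`-rational point of the cubic surface `S₁` lying on no line of the
surface (over an algebraic closure of `𝔽₄`). -/
theorem S₁_exists_F4_point_off_lines :
    ∃ v : Fin 4 → GaloisField 2 2, v ≠ 0 ∧ eval v (f₁ (GaloisField 2 2)) = 0
      ∧ ∀ W : Submodule (AlgebraicClosure (GaloisField 2 2))
            (Fin 4 → AlgebraicClosure (GaloisField 2 2)),
          Module.finrank (AlgebraicClosure (GaloisField 2 2)) W = 2 →
          (∀ w ∈ W, eval w (f₁ (AlgebraicClosure (GaloisField 2 2))) = 0) →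
          (fun i => algebraMap (GaloisField 2 2) (AlgebraicClosure (GaloisField 2 2)) (v i))
            ∉ W := by
  obtain ⟨ω, hω⟩ := GaloisField.exists_sq_add_self_add_one_eq_zero
  refine ⟨![ω, 0, 0, 1], fun h => one_ne_zero (congrFun h 3), ?_, ?_⟩
  · rw [eval_f₁]
    simp only [Matrix.cons_val]
    linear_combination hω
  intro W hW hf hv
  set K := AlgebraicClosure (GaloisField 2 2)
  have : CharP K 2 := charP_of_injective_algebraMap (algebraMap (GaloisField 2 2) K).injective 2
  have hv' : ![algebraMap (GaloisField 2 2) K ω, 0, 0, 1] ∈ W := by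
    convert hv using 1
    funext i
    fin_cases i <;> simp [K]
  have hω' : algebraMap (GaloisField 2 2) K ω ^ 2 + algebraMap (GaloisField 2 2) K ω + 1 = 0 := by
    simpa using congrArg (algebraMap (GaloisField 2 2) K) hω
  have hinj : Function.Injective ((LinearMap.proj 3 : (Fin 4 → K) →ₗ[K] K).domRestrict W) := by
    rw [injective_iff_map_eq_zero]
    rintro ⟨u, hu⟩ h3
    exact Subtype.ext (eq_zero_of_eval_f₁_add_smul_eq_zero hω' h3
      fun s => hf _ (W.add_mem hu (W.smul_mem s hv')))
  have hle := LinearMap.finrank_le_finrank_of_injective hinj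
  rw [hW, Module.finrank_self] at hle
  omega
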